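/- Let α, β ∈ (ℤI)^G be G-fixed elements of the root lattice of Q. Then the bilinear forms agree under f: (α, β)_Q = (f(α), f(β))_Γ. -/

import Mathlib

/-!
STATEMENT 0: For `G`-fixed elements `α β` of the root lattice `ℤI` of a quiver `Q`
(with admissible `G`-action), the bilinear forms agree under the bijection
`f : (ℤI)^G → ℤ𝓘`: `(α, β)_Q = (f α, f β)_Γ`.
-/

open Finset

section McKayLattice

variable (G : Type) [Group G] [Fintype G]
variable {I : Type} [Fintype I] [DecidableEq I]

/-- The orbit of a vertex under the `G`-action, as a `Finset`. -/
def orbitF [MulAction G I] (i : I) : Finset I := Finset.univ.image (fun g : G => g • i)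

/-- `d_i`, the size of the orbit of the vertex `i`. -/
def dOrb [MulAction G I] (i : I) : ℕ := (orbitF G i).card

/-- The entries of the (symmetric) Cartan matrix of the quiver `Q`, where `n i j` is the
number of edges between the vertices `i` and `j`:  `a i i = 2`, `a i j = -(n i j)` else. -/
def aMat (n : I → I → ℕ) (i j : I) : ℤ := if i = j then 2 else -(n i j : ℤ)

/-- The symmetric bilinear form `(-,-)_Q` on the root lattice `ℤI`,
determined by `(ε_i, ε_j)_Q = a i j`. -/
def pairQ (n : I → I → ℕ) (α β : I → ℤ) : ℤ := ∑ i, ∑ j, aMat n i j * α i * β j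

/-- The simple root `ε_i` in the root lattice. -/
def eps (i : I) : I → ℤ := Pi.single i 1

/-- The action of `g ∈ G` on the root lattice `ℤI`, given by `g (ε_i) = ε_{g i}`. -/
def gact [MulAction G I] (g : G) (α : I → ℤ) : I → ℤ := fun i => α (g⁻¹ • i)

variable {ι : Type} [Fintype ι] [DecidableEq ι]

/-- The symmetric matrix `B` of the valued graph `Γ` of `(Q, G)`, indexed by the set `𝓘` of
orbit representatives `rep : ι → I`:  `b k k = 2 d_k`, and for `k ≠ l`,
`b k l = -(number of edges between the orbits 𝒪_k and 𝒪_l)`. -/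
def bMat [MulAction G I] (n : I → I → ℕ) (rep : ι → I) (k l : ι) : ℤ :=
  if k = l then 2 * (dOrb G (rep k) : ℤ)
  else -(∑ i ∈ orbitF G (rep k), ∑ j ∈ orbitF G (rep l), (n i j : ℤ))

/-- The bilinear form on the root lattice `ℤ𝓘` of a valued graph determined by a symmetric
matrix `b`, via `(ε̄_k, ε̄_l)_Γ = b k l`. -/
def pairV (b : ι → ι → ℤ) (x y : ι → ℤ) : ℤ := ∑ k, ∑ l, b k l * x k * y l

/-- The canonical map `f : (ℤI)^G → ℤ𝓘`, `f (Σ α_i ε_i) = Σ_{k ∈ 𝓘} α_{rep k} ε̄_k`. -/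
def fmap (rep : ι → I) (α : I → ℤ) : ι → ℤ := fun k => α (rep k)

end McKayLattice

section OrbitSums

variable {G : Type} [Group G] [Fintype G] {I : Type} [DecidableEq I] [MulAction G I]

theorem mem_orbitF {i j : I} : j ∈ orbitF G i ↔ ∃ g : G, g • i = j := by
  simp [orbitF]

theorem mem_orbitF_of_mem_of_mem {i j r : I} (hi : i ∈ orbitF G r) (hj : j ∈ orbitF G r) :
    j ∈ orbitF G i := by
  obtain ⟨g, rfl⟩ := mem_orbitF.1 hi
  obtain ⟨h, rfl⟩ := mem_orbitF.1 hj
  exact mem_orbitF.2 ⟨h * g⁻¹, by simp [mul_smul]⟩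

/-- A fixed element of the root lattice is constant on orbits. -/
theorem apply_eq_of_mem_orbitF {α : I → ℤ} (hα : ∀ g : G, gact G g α = α) {i r : I}
    (hi : i ∈ orbitF G r) : α i = α r := by
  obtain ⟨g, rfl⟩ := mem_orbitF.1 hi
  simpa [gact] using (congrFun (hα g) (g • r)).symm

/-- A sum over all vertices splits into sums over the orbits. -/
theorem sum_eq_sum_sum_orbitF [Fintype I] {ι : Type} [Fintype ι] {rep : ι → I}
    (hrep : ∀ i : I, ∃! k : ι, i ∈ orbitF G (rep k)) (F : I → ℤ) :
    ∑ i, F i = ∑ k, ∑ i ∈ orbitF G (rep k), F i := by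
  have hcomm : ∑ k, ∑ i ∈ orbitF G (rep k), F i =
      ∑ i, ∑ k with i ∈ orbitF G (rep k), F i :=
    Finset.sum_comm' (by simp)
  rw [hcomm]
  refine Finset.sum_congr rfl fun i _ => ?_
  obtain ⟨k, hk, huniq⟩ := hrep i
  have hsingle : ({l | i ∈ orbitF G (rep l)} : Finset ι) = {k} := by
    ext l
    simp only [Finset.mem_filter_univ, Finset.mem_singleton]
    exact ⟨huniq l, fun h => h ▸ hk⟩
  rw [hsingle, Finset.sum_singleton]

/-- The entries of `bMat` are the block sums of `aMat` over pairs of orbits. -/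
theorem sum_sum_aMat_eq_bMat {ι : Type} [DecidableEq ι] {n : I → I → ℕ} {rep : ι → I}
    (hadm : ∀ i j : I, j ∈ orbitF G i → n i j = 0)
    (hrep : ∀ i : I, ∃! k : ι, i ∈ orbitF G (rep k)) (k l : ι) :
    ∑ i ∈ orbitF G (rep k), ∑ j ∈ orbitF G (rep l), aMat n i j = bMat G n rep k l := by
  by_cases hkl : k = l
  · subst hkl
    have hrow : ∀ i ∈ orbitF G (rep k), ∑ j ∈ orbitF G (rep k), aMat n i j = 2 := by
      intro i hi
      rw [Finset.sum_eq_single_of_mem i hi]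
      · simp [aMat]
      · intro j hj hji
        simp [aMat, hji.symm, hadm i j (mem_orbitF_of_mem_of_mem hi hj)]
    rw [Finset.sum_congr rfl hrow]
    simp [bMat, dOrb, mul_comm]
  · rw [bMat, if_neg hkl, ← Finset.sum_neg_distrib]
    refine Finset.sum_congr rfl fun i hi => ?_
    rw [← Finset.sum_neg_distrib]
    refine Finset.sum_congr rfl fun j hj => if_neg ?_
    rintro rfl
    exact hkl ((hrep i).unique hi hj)

end OrbitSums

/-- Let `Q` be a finite loopless quiver with an admissible action of a finite
group `G` (permuting vertices, preserving edge multiplicities), let `rep : ι → I` enumerate a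
set `𝓘` of orbit representatives, and let `Γ` be the associated valued graph with symmetric
matrix `B = bMat`.  For `G`-fixed elements `α, β ∈ (ℤI)^G` we have
`(α, β)_Q = (f α, f β)_Γ`. -/
theorem statement0
    (G : Type) [Group G] [Fintype G]
    {I : Type} [Fintype I] [DecidableEq I] [MulAction G I]
    {ι : Type} [Fintype ι] [DecidableEq ι]
    (n : I → I → ℕ) (rep : ι → I)
    (hsymm : ∀ i j, n i j = n j i)
    (hadm : ∀ i j : I, j ∈ orbitF G i → n i j = 0)
    (hinv : ∀ (g : G) (i j : I), n (g • i) (g • j) = n i j)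
    (hrep : ∀ i : I, ∃! k : ι, i ∈ orbitF G (rep k))
    (α β : I → ℤ)
    (hα : ∀ g : G, gact G g α = α) (hβ : ∀ g : G, gact G g β = β) :
    pairQ n α β = pairV (bMat G n rep) (fmap rep α) (fmap rep β) := by
  simp only [pairQ, pairV, fmap]
  rw [sum_eq_sum_sum_orbitF hrep]
  refine Finset.sum_congr rfl fun k _ => ?_
  simp_rw [sum_eq_sum_sum_orbitF hrep fun j => aMat n _ j * _ * β j]
  rw [Finset.sum_comm]
  refine Finset.sum_congr rfl fun l _ => ?_
  simp_rw [← sum_sum_aMat_eq_bMat hadm hrep, Finset.sum_mul]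
  refine Finset.sum_congr rfl fun i hi => Finset.sum_congr rfl fun j hj => ?_
  rw [apply_eq_of_mem_orbitF hα hi, apply_eq_of_mem_orbitF hβ hj]
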